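/- Let X be a real Banach space and f : X → ℝ a continuously Fréchet differentiable (C¹) function. Suppose x̄ is a local minimum of f on X (an unconstrained local minimum) and there exist ℓ > 0 and a neighborhood U of x̄ such that ‖∇f(x) − ∇f(x̄)‖ ≤ ℓ‖x − x̄‖ for all x ∈ U. Then ∇f(x̄) = 0 and the Fréchet second-order subdifferential ∂̂²f(x̄) is positive semi-definite, i.e., ⟨z, u⟩ ≥ 0 for every u ∈ X and every z ∈ ∂̂²f(x̄)(u). -/

import Mathlib

open Filter Topology

/-- The Fréchet second-order subdifferential of `f` at `xb` (relative to `∇f(xb)`),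
applied to the direction `v` (with `X` canonically embedded in `X**`):
`z ∈ ∂̂²f(xb)(v)` iff
`limsup_{x → xb} [⟨z, x − xb⟩ − ⟨∇f(x) − ∇f(xb), v⟩]/(‖x − xb‖ + ‖∇f(x) − ∇f(xb)‖) ≤ 0`. -/
def frechetSecondOrderSubdiff {X : Type*} [NormedAddCommGroup X] [NormedSpace ℝ X]
    (f : X → ℝ) (xb : X) (v : X) : Set (X →L[ℝ] ℝ) :=
  {z | Filter.limsup (fun x =>
      (z (x - xb) - (fderiv ℝ f x - fderiv ℝ f xb) v) /
        (‖x - xb‖ + ‖fderiv ℝ f x - fderiv ℝ f xb‖)) (𝓝[≠] xb) ≤ 0}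

theorem stmt_10 {X : Type*} [NormedAddCommGroup X] [NormedSpace ℝ X] [CompleteSpace X]
    (f : X → ℝ) (hf : ContDiff ℝ 1 f)
    (xb : X)
    (hmin : ∃ ε > 0, ∀ x : X, ‖x - xb‖ ≤ ε → f xb ≤ f x)
    (ℓ : ℝ) (hℓ : 0 < ℓ) (U : Set X) (hU : U ∈ 𝓝 xb)
    (hlip : ∀ x ∈ U, ‖fderiv ℝ f x - fderiv ℝ f xb‖ ≤ ℓ * ‖x - xb‖) :
    fderiv ℝ f xb = 0 ∧
    ∀ u : X, ∀ z ∈ frechetSecondOrderSubdiff f xb u, 0 ≤ z u := by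
  obtain ⟨e, he, hm⟩ := hmin
  have hloc : IsLocalMin f xb := by
    filter_upwards [Metric.closedBall_mem_nhds xb he] with x hx
    exact hm x (by simpa [dist_eq_norm] using hx)
  have h0 : fderiv ℝ f xb = 0 := hloc.fderiv_eq_zero
  refine ⟨h0, ?_⟩
  intro u z hz
  by_contra hneg
  push Not at hneg
  have hu : u ≠ 0 := by
    rintro rfl
    simp at hneg
  have hun : 0 < ‖u‖ := norm_pos_iff.mpr hu
  have hdiff : Differentiable ℝ f := hf.differentiable (by norm_num)
  simp only [frechetSecondOrderSubdiff, Set.mem_setOf_eq] at hz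
  have hpos : 0 < (-z u) / ((1 + ℓ) * ‖u‖) := by
    apply div_pos (by linarith)
    positivity
  have hb : IsBoundedUnder (· ≤ ·) (𝓝[≠] xb) (fun x =>
      (z (x - xb) - (fderiv ℝ f x - fderiv ℝ f xb) u) /
        (‖x - xb‖ + ‖fderiv ℝ f x - fderiv ℝ f xb‖)) := by
    refine isBoundedUnder_of ⟨‖z‖ + ‖u‖, fun x => ?_⟩
    apply div_le_of_le_mul₀ (by positivity) (by positivity)
    have h1 := (le_abs_self _).trans (z.le_opNorm (x - xb))
    have h2 := (neg_le_abs _).trans ((fderiv ℝ f x - fderiv ℝ f xb).le_opNorm u)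
    nlinarith [norm_nonneg z, norm_nonneg u, norm_nonneg (x - xb),
      norm_nonneg (fderiv ℝ f x - fderiv ℝ f xb),
      mul_nonneg (norm_nonneg z) (norm_nonneg (fderiv ℝ f x - fderiv ℝ f xb)),
      mul_nonneg (norm_nonneg u) (norm_nonneg (x - xb))]
  have hev := eventually_lt_of_limsup_lt (lt_of_le_of_lt hz hpos) hb
  rw [eventually_nhdsWithin_iff] at hev
  have hall := (hev.and hU).and (Metric.closedBall_mem_nhds xb he)
  obtain ⟨d, hd, hball⟩ := Metric.eventually_nhds_iff.mp hall
  have key : ∀ t : ℝ, 0 < t → t * ‖u‖ < d →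
      0 < fderiv ℝ f (xb - t • u) u ∧ f xb ≤ f (xb - t • u) := by
    intro t ht htd
    have hn : ‖xb - t • u - xb‖ = t * ‖u‖ := by
      rw [sub_sub_cancel_left, norm_neg, norm_smul, Real.norm_of_nonneg ht.le]
    obtain ⟨⟨h1, h2⟩, h3⟩ := hball (y := xb - t • u) (by rw [dist_eq_norm, hn]; exact htd)
    have htu : 0 < t * ‖u‖ := by positivity
    have hne : xb - t • u ≠ xb := by
      intro h
      rw [h] at hn
      simp at hn
      rcases hn with h | h
      · exact ht.ne' h
      · exact hu h
    have h4 := h1 hne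
    have h5 := hlip _ h2
    refine ⟨?_, hm _ (by simpa [dist_eq_norm] using h3)⟩
    rw [hn] at h4 h5
    have hD : 0 < t * ‖u‖ + ‖fderiv ℝ f (xb - t • u) - fderiv ℝ f xb‖ := by positivity
    rw [div_lt_iff₀ hD] at h4
    have h6 : (-z u) / ((1 + ℓ) * ‖u‖) *
        (t * ‖u‖ + ‖fderiv ℝ f (xb - t • u) - fderiv ℝ f xb‖) ≤ t * (-z u) := by
      calc _ ≤ (-z u) / ((1 + ℓ) * ‖u‖) * (t * ‖u‖ + ℓ * (t * ‖u‖)) := by gcongr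
        _ = t * (-z u) := by field_simp
    have h7 : z (xb - t • u - xb) = t * (-z u) := by
      rw [sub_sub_cancel_left]; simp
    rw [h7, h0, sub_zero] at h4
    rw [h0, sub_zero] at h6
    linarith
  have hT : 0 < d / (2 * ‖u‖) := by positivity
  have hTd : d / (2 * ‖u‖) * ‖u‖ < d := by
    have : d / (2 * ‖u‖) * ‖u‖ = d / 2 := by field_simp
    linarith
  have hder : ∀ t : ℝ, HasDerivAt (fun t : ℝ => f (xb - t • u))
      (fderiv ℝ f (xb - t • u) (-u)) t := by
    intro t
    have hg : HasDerivAt (fun t : ℝ => xb - t • u) (-u) t := by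
      simpa using ((hasDerivAt_id t).smul_const u).const_sub xb
    exact (hdiff _).hasFDerivAt.comp_hasDerivAt t hg
  obtain ⟨c, hc, hceq⟩ := exists_hasDerivAt_eq_slope (fun t : ℝ => f (xb - t • u)) _ hT
    (fun t _ => (hder t).continuousAt.continuousWithinAt) (fun t _ => hder t)
  have k1 := (key c hc.1 (by nlinarith [hc.2])).1
  have k2 := (key _ hT hTd).2
  have : 0 ≤ fderiv ℝ f (xb - c • u) (-u) := by
    rw [hceq]
    apply div_nonneg
    · simpa using k2
    · linarith
  rw [map_neg] at this
  linarith
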